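/- arXiv:1002.1624 — 2 statements merged into one kernel-verified Lean document; each statement's English description precedes it below -/
import Mathlib

section
/- The lexicographic ordering of the language (0+11)*01 ⊆ {0,1}* (all words in the regular language denoted by the regular expression (0+11)*01, with 0 < 1) is a countable dense linear ordering without endpoints, hence order-isomorphic to the rationals. -/
/-- The regular language `(0 + 11)* 01` over `{0,1}` (with `0 = false`, `1 = true`):
words consisting of blocks `0` or `11` followed by the suffix `01`. -/
def Rlang : Set (List Bool) :=
  {w | ∃ bs : List (List Bool),
    (∀ b ∈ bs, b = [false] ∨ b = [true, true]) ∧ w = bs.flatten ++ [false, true]}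

inductive RInd : List Bool → Prop
  | base : RInd [false, true]
  | zero {y : List Bool} : RInd y → RInd (false :: y)
  | one {y : List Bool} : RInd y → RInd (true :: true :: y)

lemma mem_Rlang_iff (w : List Bool) : w ∈ Rlang ↔ RInd w := by
  constructor
  · rintro ⟨bs, h, rfl⟩
    induction bs with
    | nil => exact RInd.base
    | cons b bs ih =>
      have ih' := ih (fun c hc => h c (List.mem_cons_of_mem _ hc))
      rcases h b List.mem_cons_self with rfl | rfl
      · exact RInd.zero ih'
      · exact RInd.one ih'
  · intro h
    induction h with
    | base => exact ⟨[], by simp, rfl⟩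
    | zero _ ih =>
      obtain ⟨bs, h, rfl⟩ := ih
      exact ⟨[false] :: bs, by simpa using h, rfl⟩
    | one _ ih =>
      obtain ⟨bs, h, rfl⟩ := ih
      exact ⟨[true, true] :: bs, by simpa using h, rfl⟩

lemma RInd.zero_lt {y : List Bool} (h : RInd y) : List.Lex (· < ·) (false :: y) y := by
  induction h with
  | base => exact .cons (.rel (by decide))
  | zero _ ih => exact .cons ih
  | one _ _ => exact .rel (by decide)

lemma RInd.ext {u x : List Bool} (h : RInd u) (hx : RInd x) : RInd (u ++ true :: x) := by
  induction h with
  | base => exact .zero (.one hx)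
  | zero _ ih => exact .zero ih
  | one _ ih => exact .one ih

lemma RInd.ext_inv {u t : List Bool} (h : RInd u) (ht : t ≠ []) (hut : RInd (u ++ t)) :
    ∃ y, RInd y ∧ t = true :: y := by
  induction h with
  | base =>
    cases hut with
    | base => exact absurd rfl ht
    | zero h =>
      cases h with
      | one h => exact ⟨_, h, rfl⟩
  | @zero y hy ih =>
    generalize hw : false :: y ++ t = w at hut
    cases hut with
    | base => cases hy <;> simp at hw
    | zero h => 
      simp at hw
      exact ih (hw ▸ h)
    | one h => simp at hw
  | one _ ih =>
    cases hut with
    | one h => exact ih h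

lemma lex_append_right (u t : List Bool) (ht : t ≠ []) : List.Lex (· < ·) u (u ++ t) := by
  induction u with
  | nil =>
    cases t with
    | nil => exact absurd rfl ht
    | cons => exact .nil
  | cons a u ih => exact .cons ih

lemma lex_append_left (u : List Bool) {a b : List Bool} (h : List.Lex (· < ·) a b) :
    List.Lex (· < ·) (u ++ a) (u ++ b) := by
  induction u with
  | nil => exact h
  | cons a u ih => exact .cons ih

lemma lex_cases {u v : List Bool} (h : List.Lex (· < ·) u v) :
    (∃ t, t ≠ [] ∧ v = u ++ t) ∨ ∀ t, List.Lex (· < ·) (u ++ t) v := by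
  induction h with
  | nil => exact .inl ⟨_, by simp, rfl⟩
  | rel h => exact .inr fun t => .rel h
  | cons _ ih =>
    rcases ih with ⟨t, ht, rfl⟩ | h
    · exact .inl ⟨t, ht, rfl⟩
    · exact .inr fun t => .cons (h t)

lemma Rlang_dense (u v : ↥Rlang) (h : List.Lex (· < ·) u.1 v.1) :
    ∃ w : ↥Rlang, List.Lex (· < ·) u.1 w.1 ∧ List.Lex (· < ·) w.1 v.1 := by
  obtain ⟨u, hu⟩ := u
  obtain ⟨v, hv⟩ := v
  have hu' := (mem_Rlang_iff u).1 hu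
  have hv' := (mem_Rlang_iff v).1 hv
  rcases lex_cases h with ⟨t, ht, hvt⟩ | h
  · simp only at hvt
    subst hvt
    obtain ⟨y, hy, rfl⟩ := hu'.ext_inv ht hv'
    exact ⟨⟨u ++ true :: false :: y, (mem_Rlang_iff _).2 (hu'.ext hy.zero)⟩,
      lex_append_right _ _ (by simp), lex_append_left _ (.cons hy.zero_lt)⟩
  · exact ⟨⟨u ++ true :: [false, true], (mem_Rlang_iff _).2 (hu'.ext .base)⟩,
      lex_append_right _ _ (by simp), h _⟩

lemma Rlang_noMin (u : ↥Rlang) : ∃ v : ↥Rlang, List.Lex (· < ·) v.1 u.1 :=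
  have hu := (mem_Rlang_iff _).1 u.2
  ⟨⟨false :: u.1, (mem_Rlang_iff _).2 hu.zero⟩, hu.zero_lt⟩

lemma Rlang_noMax (u : ↥Rlang) : ∃ v : ↥Rlang, List.Lex (· < ·) u.1 v.1 :=
  have hu := (mem_Rlang_iff _).1 u.2
  ⟨⟨u.1 ++ true :: [false, true], (mem_Rlang_iff _).2 (hu.ext .base)⟩,
    lex_append_right _ _ (by simp)⟩

/-- The lexicographic ordering of the language `(0+11)*01` is a countable dense
linear ordering without endpoints, hence order-isomorphic to the rationals. -/
theorem Rlang_lex_dense_iso_rat :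
    Countable ↥Rlang ∧
    (∀ u v : ↥Rlang, List.Lex (· < ·) u.1 v.1 →
      ∃ w : ↥Rlang, List.Lex (· < ·) u.1 w.1 ∧ List.Lex (· < ·) w.1 v.1) ∧
    (∀ u : ↥Rlang, ∃ v : ↥Rlang, List.Lex (· < ·) v.1 u.1) ∧
    (∀ u : ↥Rlang, ∃ v : ↥Rlang, List.Lex (· < ·) u.1 v.1) ∧
    Nonempty (RelIso (fun u v : ↥Rlang => List.Lex (· < ·) u.1 v.1)
      ((· < ·) : ℚ → ℚ → Prop)) := by
  refine ⟨inferInstance, Rlang_dense, Rlang_noMin, Rlang_noMax, ?_⟩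
  haveI : DenselyOrdered ↥Rlang := ⟨fun u v h => Rlang_dense u v h⟩
  haveI : NoMinOrder ↥Rlang := ⟨fun u => Rlang_noMin u⟩
  haveI : NoMaxOrder ↥Rlang := ⟨fun u => Rlang_noMax u⟩
  haveI : Nonempty ↥Rlang := ⟨⟨[false, true], (mem_Rlang_iff _).2 .base⟩⟩
  obtain ⟨e⟩ := Order.iso_of_countable_dense ↥Rlang ℚ
  exact ⟨⟨e.toEquiv, fun {a b} => e.lt_iff_lt⟩⟩
end

section
/- Let G be a scattered grammar over {0,1} with n nonterminals, ε-free, chain-free, with each nonterminal generating at least two words. Then the Hausdorff rank of (L(G), <_ℓ) is at most ω^{n-1} + 1; in particular, r((L(G), <_ℓ)) < ω^ω. -/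
/-- A linear(ish) ordering `(σ, r)` is scattered if it has no dense subordering:
no subset `S` with at least two comparable points such that between any two
`r`-related points of `S` there is a third point of `S`. -/
def ScatteredRel (σ : Type) (r : σ → σ → Prop) : Prop :=
  ¬ ∃ S : Set σ, (∃ a ∈ S, ∃ b ∈ S, r a b) ∧
      ∀ a ∈ S, ∀ b ∈ S, r a b → ∃ c ∈ S, r a c ∧ r c b

/-- Hausdorff's hierarchy: `InV a σ r` means the ordering `(σ, r)` belongs to the
class `V_a`, where `V_0` consists of the empty and one-point orderings and `V_a`
consists of all orderings isomorphic to a `ℤ`-indexed sum of orderings from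
`⋃_{b < a} V_b`. -/
inductive InV : Ordinal.{0} → ∀ (σ : Type), (σ → σ → Prop) → Prop
  | zero (σ : Type) (r : σ → σ → Prop) : Subsingleton σ → InV 0 σ r
  | sum (a : Ordinal.{0}) (Q : ℤ → Type) (rQ : ∀ n, Q n → Q n → Prop)
      (o : ℤ → Ordinal.{0}) (ho : ∀ n, o n < a)
      (h : ∀ n, InV (o n) (Q n) (rQ n))
      (σ : Type) (r : σ → σ → Prop) (e : (Σ n : ℤ, Q n) ≃ σ)
      (he : ∀ x y, Sigma.Lex (· < ·) rQ x y ↔ r (e x) (e y)) :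
      InV a σ r

/-- The Hausdorff rank of an ordering: the least ordinal `a` with `(σ, r) ∈ V_a`. -/
noncomputable def hrank (σ : Type) (r : σ → σ → Prop) : Ordinal.{0} :=
  sInf {a | InV a σ r}

/-- A prefix language: no word is a proper prefix of another word of the language. -/
def IsPrefixLanguage (L : Set (List Bool)) : Prop :=
  ∀ u ∈ L, ∀ v ∈ L, u <+: v → u = v

/-- The language of terminal words generated from the nonterminal `X`. -/
def langOf (g : ContextFreeGrammar.{0} Bool) (X : g.NT) : Set (List Bool) :=
  {w | g.Derives [Symbol.nonterminal X] (w.map Symbol.terminal)}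

/-- A language is scattered when its lexicographic ordering is scattered. -/
def LexScattered (L : Set (List Bool)) : Prop :=
  ScatteredRel ↥L (fun u v => List.Lex (· < ·) u.1 v.1)

/-- A prefix grammar: every nonterminal generates a prefix language. -/
def IsPrefixGrammar (g : ContextFreeGrammar.{0} Bool) : Prop :=
  ∀ X : g.NT, IsPrefixLanguage (langOf g X)

/-- No useless nonterminals: every nonterminal is reachable from the start symbol
and generates at least one terminal word. -/
def NoUselessNonterminals (g : ContextFreeGrammar.{0} Bool) : Prop :=
  ∀ X : g.NT,
    (∃ p q : List (Symbol Bool g.NT),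
      g.Derives [Symbol.nonterminal g.initial] (p ++ [Symbol.nonterminal X] ++ q)) ∧
    (langOf g X).Nonempty

/-- The Hausdorff rank of the lexicographic ordering of a language. -/
noncomputable def langRank (L : Set (List Bool)) : Ordinal.{0} :=
  hrank ↥L (fun u v => List.Lex (· < ·) u.1 v.1)


/-! ### Set-based Hausdorff hierarchy inside a linear order -/

inductive HV {M : Type} [LinearOrder M] : Ordinal.{0} → Set M → Prop
  | sub (S : Set M) : S.Subsingleton → HV 0 S
  | sum (a : Ordinal.{0}) (S : Set M) (f : M → ℤ) (o : ℤ → Ordinal.{0}) (hf : MonotoneOn f S)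
      (ho : ∀ n, o n < a) (h : ∀ n, HV (o n) (S ∩ f ⁻¹' {n})) : HV a S

section HVsec
variable {M : Type} [LinearOrder M]

theorem HV.of_subsingleton {S : Set M} (hS : S.Subsingleton) (a : Ordinal.{0}) : HV a S := by
  rcases eq_or_ne a 0 with rfl | ha
  · exact HV.sub S hS
  · exact HV.sum a S (fun _ => 0) (fun _ => 0) (fun _ _ _ _ _ => le_rfl)
      (fun _ => pos_iff_ne_zero.mpr ha) (fun n => HV.sub _ (hS.anti Set.inter_subset_left))

theorem HV.mono {a b : Ordinal.{0}} {S : Set M} (h : HV a S) (hab : a ≤ b) : HV b S := by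
  cases h with
  | sub _ hS => exact HV.of_subsingleton hS b
  | sum _ _ f o hf ho h => exact HV.sum b S f o hf (fun n => (ho n).trans_le hab) h

theorem HV.subset {a : Ordinal.{0}} {S : Set M} (h : HV a S) : ∀ T ⊆ S, HV a T := by
  induction h with
  | sub S hS => exact fun T hT => HV.sub T (hS.anti hT)
  | sum a S f o hf ho h ih =>
    intro T hT
    exact HV.sum a T f o (hf.mono hT) ho
      (fun n => ih n _ (Set.inter_subset_inter_left _ hT))

theorem HV.sum' {a : Ordinal.{0}} {S : Set M} (f : M → ℤ) (hf : MonotoneOn f S)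
    (h : ∀ n, ∃ b < a, HV b (S ∩ f ⁻¹' {n})) : HV a S := by
  choose o ho h using h
  exact HV.sum a S f o hf ho h

theorem HV.union_aux {b c : Ordinal.{0}} {S T : Set M} (hT : HV b T) (hbc : b ≤ c)
    (hM : HV c ((S ∪ T) ∩ {x | (∃ s ∈ S, s ≤ x) ∧ ∃ s ∈ S, x ≤ s})) : HV (c + 1) (S ∪ T) := by
  classical
  have hlt : c < c + 1 := by simp
  refine HV.sum' (fun x => if ∀ s ∈ S, x < s then 0 else if ∀ s ∈ S, s < x then 2 else 1) ?_ ?_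
  · intro x _ y _ hxy
    dsimp only
    by_cases h1 : ∀ s ∈ S, x < s
    · rw [if_pos h1]
      split_ifs <;> norm_num
    · have h1' : ¬ ∀ s ∈ S, y < s := fun h => h1 (fun s hs => hxy.trans_lt (h s hs))
      rw [if_neg h1, if_neg h1']
      by_cases h2 : ∀ s ∈ S, s < x
      · have h2' : ∀ s ∈ S, s < y := fun s hs => (h2 s hs).trans_le hxy
        rw [if_pos h2, if_pos h2']
      · rw [if_neg h2]
        split_ifs <;> norm_num
  · intro n
    by_cases hn : n = 1
    · subst hn
      refine ⟨c, hlt, hM.subset _ ?_⟩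
      rintro x ⟨hx, hx'⟩
      refine ⟨hx, ?_⟩
      simp only [Set.mem_preimage, Set.mem_singleton_iff] at hx'
      split_ifs at hx' with h1 h2
      · simp at hx'
      · simp at hx'
      · push Not at h1 h2
        exact ⟨h1, h2⟩
    · refine ⟨c, hlt, (hT.mono hbc).subset _ ?_⟩
      rintro x ⟨hx | hx, hx'⟩
      · exfalso
        simp only [Set.mem_preimage, Set.mem_singleton_iff] at hx'
        split_ifs at hx' with h1 h2
        · exact lt_irrefl _ (h1 x hx)
        · exact lt_irrefl _ (h2 x hx)
        · exact hn hx'.symm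
      · exact hx

theorem HV.union {a : Ordinal.{0}} {S : Set M} (hS : HV a S) : ∀ {b : Ordinal.{0}} {T : Set M},
    HV b T → HV (b + 2 * a + 1) (S ∪ T) := by
  induction hS with
  | sub S hS =>
    intro b T hT
    refine HV.union_aux hT (by simp) ?_
    apply HV.of_subsingleton
    refine hS.anti ?_
    rintro x ⟨_, ⟨s, hs, hsx⟩, ⟨t, ht, htx⟩⟩
    have : s = t := hS hs ht
    subst this
    rwa [le_antisymm htx hsx]
  | sum a S f o hf ho h ih =>
    intro b T hT
    refine HV.union_aux hT le_self_add ?_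
    set H : Set M := {x | (∃ s ∈ S, s ≤ x) ∧ ∃ s ∈ S, x ≤ s} with hH
    let F : M → ℤ := fun x => sSup (f '' (S ∩ Set.Iic x))
    have hne : ∀ x ∈ H, (f '' (S ∩ Set.Iic x)).Nonempty := by
      rintro x ⟨⟨s, hs, hsx⟩, _⟩
      exact ⟨f s, s, ⟨hs, hsx⟩, rfl⟩
    have hbd : ∀ x ∈ H, BddAbove (f '' (S ∩ Set.Iic x)) := by
      rintro x ⟨_, ⟨t, ht, htx⟩⟩
      refine ⟨f t, ?_⟩
      rintro _ ⟨s, ⟨hs, hsx⟩, rfl⟩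
      exact hf hs ht (le_trans hsx htx)
    have hF : ∀ s ∈ S, F s = f s := by
      intro s hs
      refine le_antisymm ?_ ?_
      · refine csSup_le (hne s ⟨⟨s, hs, le_rfl⟩, ⟨s, hs, le_rfl⟩⟩) ?_
        rintro _ ⟨t, ⟨ht, hts⟩, rfl⟩
        exact hf ht hs hts
      · exact le_csSup (hbd s ⟨⟨s, hs, le_rfl⟩, ⟨s, hs, le_rfl⟩⟩) ⟨s, ⟨hs, le_rfl⟩, rfl⟩
    refine HV.sum' F ?_ ?_
    · intro x hx y hy hxy
      refine csSup_le_csSup (hbd y hy.2) (hne x hx.2) ?_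
      refine Set.image_mono (Set.inter_subset_inter_right _ (Set.Iic_subset_Iic.mpr hxy))
    · intro n
      refine ⟨b + 2 * o n + 1, ?_, (ih n hT).subset _ ?_⟩
      · have h1 : 2 * (o n + 1) ≤ 2 * a := by
          have : o n + 1 ≤ a := Order.add_one_le_of_lt (ho n)
          gcongr
        calc b + 2 * o n + 1 < b + 2 * o n + 1 + 1 := by simp
          _ = b + 2 * (o n + 1) := by
              rw [mul_add, mul_one, add_assoc, add_assoc, one_add_one_eq_two]
          _ ≤ b + 2 * a := by gcongr
      · rintro x ⟨⟨hx | hx, hxH⟩, hxn⟩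
        · left
          exact ⟨hx, by simpa [hF x hx] using hxn⟩
        · right
          exact hx

theorem HV.locfin {S : Set M} (f : M → ℤ) (hf : MonotoneOn f S)
    (h : ∀ n, (S ∩ f ⁻¹' {n}).Finite) : HV 1 S := by
  classical
  by_cases hne : S.Nonempty
  swap
  · rw [Set.not_nonempty_iff_eq_empty] at hne
    subst hne
    exact HV.of_subsingleton Set.subsingleton_empty 1
  obtain ⟨x0, hx0⟩ := hne
  let : LocallyFiniteOrder S := LocallyFiniteOrder.ofFiniteIcc (by
    intro a b
    have : (⋃ n ∈ Set.Icc (f a) (f b), (S ∩ f ⁻¹' {n})).Finite :=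
      (Set.finite_Icc _ _).biUnion (fun n _ => h n)
    refine Set.Finite.of_finite_image (f := Subtype.val) (this.subset ?_)
      Subtype.val_injective.injOn
    rintro _ ⟨x, hx, rfl⟩
    simp only [Set.mem_iUnion]
    exact ⟨f x, ⟨hf a.2 x.2 hx.1, hf x.2 b.2 hx.2⟩, x.2, rfl⟩)
  let := LinearLocallyFiniteOrder.succOrder (ι := S)
  let := LinearLocallyFiniteOrder.predOrder (ι := S)
  let F : M → ℤ := fun x => if hx : x ∈ S then toZ (⟨x0, hx0⟩ : S) ⟨x, hx⟩ else 0
  refine HV.sum' F ?_ ?_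
  · intro x hx y hy hxy
    simp only [F, hx, hy, dif_pos]
    exact toZ_le_toZ.mpr hxy
  · intro n
    refine ⟨0, zero_lt_one, HV.sub _ ?_⟩
    rintro x ⟨hx, hxn⟩ y ⟨hy, hyn⟩
    simp only [F, Set.mem_preimage, Set.mem_singleton_iff, hx, hy, dif_pos] at hxn hyn
    have := toZ_inj.mp (hxn.trans hyn.symm)
    exact congrArg Subtype.val this

theorem HV.inV {a : Ordinal.{0}} {S : Set M} (h : HV a S) :
    InV a S (fun u v => u.1 < v.1) := by
  induction h with
  | sub S hS => exact InV.zero _ _ (Set.subsingleton_coe S |>.mpr hS)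
  | sum a S f o hf ho h ih =>
    let e : (Σ n : ℤ, ↥(S ∩ f ⁻¹' {n})) ≃ S :=
      { toFun := fun p => ⟨p.2.1, p.2.2.1⟩
        invFun := fun x => ⟨f x.1, ⟨x.1, x.2, rfl⟩⟩
        left_inv := by
          rintro ⟨n, ⟨x, hx, hxn⟩⟩
          have hxn' : f x = n := hxn
          subst hxn'
          rfl
        right_inv := fun x => rfl }
    refine InV.sum a (fun n => ↥(S ∩ f ⁻¹' {n})) (fun n u v => u.1 < v.1) o ho ih _ _ e ?_
    rintro ⟨n, ⟨x, hx, hxn⟩⟩ ⟨m, ⟨y, hy, hym⟩⟩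
    have hxn' : f x = n := hxn
    have hym' : f y = m := hym
    subst hxn' hym'
    show _ ↔ x < y
    constructor
    · intro hl
      generalize hp : (⟨f x, ⟨x, hx, hxn⟩⟩ : Σ n : ℤ, ↥(S ∩ f ⁻¹' {n})) = p at hl
      generalize hq : (⟨f y, ⟨y, hy, hym⟩⟩ : Σ n : ℤ, ↥(S ∩ f ⁻¹' {n})) = q at hl
      have hpx : p.2.1 = x := by rw [← hp]
      have hqx : q.2.1 = y := by rw [← hq]
      cases hl with
      | left u v huv =>
        by_contra hlt
        have h1 := hf hy hx (not_lt.mp hlt)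
        have h2 := congrArg Sigma.fst hp
        have h3 := congrArg Sigma.fst hq
        simp only at h2 h3
        omega
      | right u v huv =>
        simp only at hpx hqx
        rw [← hpx, ← hqx]; exact huv
    · intro hxy
      rcases (hf hx hy hxy.le).lt_or_eq with hlt | heq
      · exact Sigma.Lex.left _ _ hlt
      · have key : ∀ n (hn : f x = n) (hm : f y = n), Sigma.Lex (· < ·)
            (fun n (u v : ↥(S ∩ f ⁻¹' {n})) => u.1 < v.1)
            ⟨n, ⟨x, hx, hn⟩⟩ ⟨n, ⟨y, hy, hm⟩⟩ := fun n hn hm => Sigma.Lex.right _ _ hxy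
        have h2 := key (f y) heq rfl
        have h3 : ∀ k (hk : f x = k),
            (⟨f x, ⟨x, hx, hxn⟩⟩ : Σ n : ℤ, ↥(S ∩ f ⁻¹' {n})) = ⟨k, ⟨x, hx, hk⟩⟩ := by
          intro k hk
          subst hk
          rfl
        rw [h3 _ heq]
        exact h2

/-- The class of sets of rank `< ω^h` (finite sets if `h = 0`). -/
def CH (h : ℕ) (S : Set M) : Prop :=
  (h = 0 ∧ S.Finite) ∨ (1 ≤ h ∧ ∃ b < Ordinal.omega0 ^ (h : Ordinal.{0}), HV b S)

theorem CH.subset {h : ℕ} {S T : Set M} (hS : CH h S) (hT : T ⊆ S) : CH h T := by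
  rcases hS with ⟨h0, hS⟩ | ⟨h1, b, hb, hS⟩
  · exact Or.inl ⟨h0, hS.subset hT⟩
  · exact Or.inr ⟨h1, b, hb, hS.subset _ hT⟩

theorem CH.of_subsingleton {h : ℕ} {S : Set M} (hS : S.Subsingleton) : CH h S := by
  rcases Nat.eq_zero_or_pos h with h0 | h1
  · exact Or.inl ⟨h0, hS.finite⟩
  · exact Or.inr ⟨h1, 0, Ordinal.opow_pos _ Ordinal.omega0_pos, HV.sub _ hS⟩

theorem two_mul_lt_opow {h : ℕ} (h1 : 1 ≤ h) {a : Ordinal.{0}}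
    (ha : a < Ordinal.omega0 ^ (h : Ordinal.{0})) :
    2 * a < Ordinal.omega0 ^ (h : Ordinal.{0}) := by
  obtain ⟨k, rfl⟩ : ∃ k, h = 1 + k := ⟨h - 1, by omega⟩
  have h2 : 2 * Ordinal.omega0 ^ ((1 + k : ℕ) : Ordinal.{0})
      = Ordinal.omega0 ^ ((1 + k : ℕ) : Ordinal.{0}) := by
    push_cast
    rw [Ordinal.opow_add, Ordinal.opow_one, ← mul_assoc]
    congr 1
    exact_mod_cast Ordinal.natCast_mul_omega0 (n := 2) (by norm_num)
  rw [← h2]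
  exact (mul_lt_mul_iff_right₀ (by norm_num)).mpr ha

theorem one_lt_opow' {h : ℕ} (h1 : 1 ≤ h) : 1 < Ordinal.omega0 ^ (h : Ordinal.{0}) :=
  Ordinal.one_lt_opow.mpr ⟨Ordinal.one_lt_omega0, by exact_mod_cast (by omega : h ≠ 0)⟩

theorem CH.union {h : ℕ} {S T : Set M} (hS : CH h S) (hT : CH h T) : CH h (S ∪ T) := by
  rcases hS with ⟨h0, hS⟩ | ⟨h1, a, ha, hS⟩
  · rcases hT with ⟨h0, hT⟩ | ⟨h1, b, hb, hT⟩
    · exact Or.inl ⟨h0, hS.union hT⟩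
    · omega
  · rcases hT with ⟨h0, hT⟩ | ⟨h1, b, hb, hT⟩
    · omega
    · refine Or.inr ⟨h1, _, ?_, hS.union hT⟩
      have hp := Ordinal.isPrincipal_add_omega0_opow (h : Ordinal.{0})
      exact hp (hp hb (two_mul_lt_opow h1 ha)) (one_lt_opow' h1)

theorem CH.biUnion {h : ℕ} {ι : Type*} (s : Finset ι) (A : ι → Set M)
    (hA : ∀ i ∈ s, CH h (A i)) : CH h (⋃ i ∈ s, A i) := by
  classical
  induction s using Finset.induction_on with
  | empty => exact CH.of_subsingleton (by simp)
  | insert i s hi ih =>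
    rw [Finset.set_biUnion_insert]
    exact (hA i (by simp)).union (ih (fun j hj => hA j (by simp [hj])))

theorem CH.sum {h : ℕ} {S : Set M} (f : M → ℤ) (hf : MonotoneOn f S)
    (hS : ∀ n, CH h (S ∩ f ⁻¹' {n})) : HV (Ordinal.omega0 ^ (h : Ordinal.{0})) S := by
  rcases Nat.eq_zero_or_pos h with h0 | h1
  · subst h0
    simp only [Nat.cast_zero, Ordinal.opow_zero]
    refine HV.locfin f hf (fun n => ?_)
    rcases hS n with ⟨_, h⟩ | ⟨h, _⟩
    · exact h
    · omega
  · refine HV.sum' f hf (fun n => ?_)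
    rcases hS n with ⟨h, _⟩ | ⟨_, h⟩
    · omega
    · exact h

theorem CH.of_lower {h k : ℕ} (hk : k < h) {S : Set M}
    (hS : HV (Ordinal.omega0 ^ (k : Ordinal.{0}) + 1) S) : CH h S := by
  refine Or.inr ⟨by omega, _, ?_, hS⟩
  have hp := Ordinal.isPrincipal_add_omega0_opow (h : Ordinal.{0})
  refine hp ?_ (one_lt_opow' (by omega))
  exact (Ordinal.opow_lt_opow_iff_right Ordinal.one_lt_omega0).mpr (by exact_mod_cast hk)

end HVsec

/-! ### Words -/

theorem word_lt_iff (x y : List Bool) : x < y ↔ List.Lex (· < ·) x y := Iff.rfl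

theorem append_lt_append_iff (u x y : List Bool) : u ++ x < u ++ y ↔ x < y := by
  induction u with
  | nil => rfl
  | cons a u ih => simpa [List.cons_lt_cons_iff] using ih

theorem append_le_append_iff (u x y : List Bool) : u ++ x ≤ u ++ y ↔ x ≤ y := by
  rw [← not_lt, ← not_lt, append_lt_append_iff]

/-- `x` and `y` diverge, with `x` below `y`. -/
def DivLt (x y : List Bool) : Prop :=
  ∃ p q r, x = p ++ false :: q ∧ y = p ++ true :: r

theorem DivLt.append {x y : List Bool} (h : DivLt x y) (s t : List Bool) :
    DivLt (x ++ s) (y ++ t) := by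
  obtain ⟨p, q, r, rfl, rfl⟩ := h
  exact ⟨p, q ++ s, r ++ t, by simp, by simp⟩

theorem DivLt.append_left {x y : List Bool} (h : DivLt x y) (s : List Bool) :
    DivLt (s ++ x) (s ++ y) := by
  obtain ⟨p, q, r, rfl, rfl⟩ := h
  exact ⟨s ++ p, q, r, by simp, by simp⟩

theorem DivLt.lt {x y : List Bool} (h : DivLt x y) : x < y := by
  obtain ⟨p, q, r, rfl, rfl⟩ := h
  rw [append_lt_append_iff]
  simp [List.cons_lt_cons_iff]

theorem word_cases (x y : List Bool) : DivLt x y ∨ DivLt y x ∨ x <+: y ∨ y <+: x := by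
  induction x generalizing y with
  | nil => simp
  | cons a x ih =>
    cases y with
    | nil => simp
    | cons b y =>
      by_cases hab : a = b
      · subst hab
        rcases ih y with h | h | h | h
        · exact Or.inl (h.append_left [a])
        · exact Or.inr (Or.inl (h.append_left [a]))
        · right; right; left; simpa [List.cons_prefix_cons] using h
        · right; right; right; simpa [List.cons_prefix_cons] using h
      · cases a <;> cases b
        · simp at hab
        · exact Or.inl ⟨[], x, y, rfl, rfl⟩
        · exact Or.inr (Or.inl ⟨[], y, x, rfl, rfl⟩)
        · simp at hab

theorem prefix_le {x y : List Bool} (h : x <+: y) : x ≤ y := by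
  obtain ⟨t, rfl⟩ := h
  have : x ++ [] ≤ x ++ t := by
    rw [append_le_append_iff]
    rw [← not_lt]
    simp
  simpa using this

theorem IsPrefixLanguage.mono {A B : Set (List Bool)} (h : IsPrefixLanguage A) (hB : B ⊆ A) :
    IsPrefixLanguage B := fun u hu v hv => h u (hB hu) v (hB hv)

theorem IsPrefixLanguage.unique {A : Set (List Bool)} (h : IsPrefixLanguage A)
    {u v w : List Bool} (hu : u ∈ A) (hv : v ∈ A) (huw : u <+: w) (hvw : v <+: w) : u = v := by
  rcases List.prefix_or_prefix_of_prefix huw hvw with h1 | h1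
  · exact h u hu v hv h1
  · exact (h v hv u hu h1).symm

theorem IsPrefixLanguage.le_of_append {A : Set (List Bool)} (h : IsPrefixLanguage A)
    {u v s t : List Bool} (hu : u ∈ A) (hv : v ∈ A) (hle : u ++ s ≤ v ++ t) : u ≤ v := by
  rcases word_cases u v with h1 | h1 | h1 | h1
  · exact h1.lt.le
  · exact absurd (h1.append t s).lt (not_lt.mpr hle)
  · exact prefix_le h1
  · exact (h v hv u hu h1).symm.le

theorem HV.shift {b : Ordinal.{0}} {B : Set (List Bool)} (hB : HV b B) (u : List Bool) :
    HV b ((fun v => u ++ v) '' B) := by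
  induction hB with
  | sub S hS => exact HV.sub _ (hS.image _)
  | sum a S f o hf ho h ih =>
    refine HV.sum a _ (fun w => f (w.drop u.length)) o ?_ ho ?_
    · rintro _ ⟨x, hx, rfl⟩ _ ⟨y, hy, rfl⟩ hxy
      simp only [append_le_append_iff] at hxy
      simpa using hf hx hy hxy
    · intro n
      refine (ih n).subset _ ?_
      rintro _ ⟨⟨x, hx, rfl⟩, hn⟩
      refine ⟨x, ⟨hx, by simpa using hn⟩, rfl⟩

theorem HV.concat {a : Ordinal.{0}} {A : Set (List Bool)} (hA : HV a A) :
    IsPrefixLanguage A → ∀ {b : Ordinal.{0}} {B : Set (List Bool)}, HV b B →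
    HV (b + a) (Set.image2 (· ++ ·) A B) := by
  classical
  induction hA with
  | sub S hS =>
    intro _ b B hB
    rcases hS.eq_empty_or_singleton with rfl | ⟨u, rfl⟩
    · exact HV.of_subsingleton (by simp) _
    · rw [Set.image2_singleton_left, add_zero]
      exact hB.shift u
  | sum a S f o hf ho h ih =>
    intro hp b B hB
    let F : List Bool → ℤ := fun w =>
      if hw : ∃ u ∈ S, u <+: w then f hw.choose else 0
    have hF : ∀ u ∈ S, ∀ v, F (u ++ v) = f u := by
      intro u hu v
      have hw : ∃ u' ∈ S, u' <+: u ++ v := ⟨u, hu, List.prefix_append _ _⟩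
      have := hp.unique hw.choose_spec.1 hu hw.choose_spec.2 (List.prefix_append _ _)
      simp only [F, dif_pos hw, this]
    refine HV.sum _ _ F (fun n => b + o n) ?_ (fun n => by gcongr; exact ho n) ?_
    · rintro _ ⟨u, hu, v, hv, rfl⟩ _ ⟨u', hu', v', hv', rfl⟩ hle
      simp only [hF u hu, hF u' hu']
      exact hf hu hu' (hp.le_of_append hu hu' hle)
    · intro n
      refine (ih n (hp.mono Set.inter_subset_left) hB).subset _ ?_
      rintro _ ⟨⟨u, hu, v, hv, rfl⟩, hn⟩
      refine ⟨u, ⟨hu, ?_⟩, v, hv, rfl⟩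
      simpa [hF u hu] using hn

theorem CH.concat {h : ℕ} {A B : Set (List Bool)} (hA : CH h A) (hB : CH h B)
    (hp : IsPrefixLanguage A) : CH h (Set.image2 (· ++ ·) A B) := by
  rcases hA with ⟨h0, hA⟩ | ⟨h1, a, ha, hA⟩
  · rcases hB with ⟨h0, hB⟩ | ⟨h1, b, hb, hB⟩
    · exact Or.inl ⟨h0, hA.image2 _ hB⟩
    · omega
  · rcases hB with ⟨h0, hB⟩ | ⟨h1, b, hb, hB⟩
    · omega
    · refine Or.inr ⟨h1, _, ?_, hA.concat hp hB⟩
      exact Ordinal.isPrincipal_add_omega0_opow (h : Ordinal.{0}) hb ha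

/-- Rank bound from an approximating infinite word `U`. -/
theorem rank_of_spine {h : ℕ} {L : Set (List Bool)} (U : ℕ → List Bool)
    (hU : ∀ m, (U m).length = m)
    (hD : ∀ m, CH h {w ∈ L | ¬ U m <+: w}) :
    HV (Ordinal.omega0 ^ (h : Ordinal.{0}) + 1) L := by
  classical
  have hex : ∀ w : List Bool, ∃ m, ¬ U m <+: w := fun w => ⟨w.length + 1, fun hp => by
    have := hp.length_le
    rw [hU] at this
    omega⟩
  let d : List Bool → ℕ := fun w => Nat.find (hex w)
  have hd : ∀ w, ¬ U (d w) <+: w := fun w => Nat.find_spec (hex w)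
  have hdlt : ∀ w m, m < d w → U m <+: w := fun w m hm => not_not.mp (Nat.find_min (hex w) hm)
  -- position of a word with smaller divergence index
  have key : ∀ w x, U (d w) <+: x → (w < U (d w) → w < x) ∧ (U (d w) < w → x < w) := by
    intro w x hx
    obtain ⟨t, ht⟩ := hx
    rcases word_cases w (U (d w)) with h1 | h1 | h1 | h1
    · have h2 := (h1.append [] t).lt
      rw [ht, List.append_nil] at h2
      exact ⟨fun _ => h2, fun h3 => absurd h3 (not_lt.mpr h1.lt.le)⟩
    · have h2 := (h1.append t []).lt
      rw [ht, List.append_nil] at h2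
      exact ⟨fun h3 => absurd h3 (not_lt.mpr h1.lt.le), fun _ => h2⟩
    · have h2 : w <+: x := h1.trans ⟨t, ht⟩
      refine ⟨fun h3 => lt_of_lt_of_le h3 (prefix_le ⟨t, ht⟩), fun h3 => ?_⟩
      exact absurd h3 (not_lt.mpr (prefix_le h1))
    · exact absurd h1 (hd w)
  have hne : ∀ w, w ≠ U (d w) := fun w he => hd w (he ▸ List.prefix_rfl)
  have hlow : HV (Ordinal.omega0 ^ (h : Ordinal.{0})) (L ∩ {w | w < U (d w)}) := by
    refine CH.sum (fun w => (d w : ℤ)) ?_ ?_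
    · rintro x ⟨_, hx⟩ y ⟨_, hy⟩ hxy
      by_contra hlt
      have hlt' : d y < d x := by simpa using hlt
      exact absurd ((key y x (hdlt x _ hlt')).1 hy) (not_lt.mpr hxy)
    · intro n
      refine (hD n.toNat).subset ?_
      rintro x ⟨⟨hx, _⟩, hn⟩
      have hn' : (d x : ℤ) = n := hn
      refine ⟨hx, ?_⟩
      rw [← hn', Int.toNat_natCast]
      exact hd x
  have hhigh : HV (Ordinal.omega0 ^ (h : Ordinal.{0})) (L ∩ {w | U (d w) < w}) := by
    refine CH.sum (fun w => -(d w : ℤ)) ?_ ?_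
    · rintro x ⟨_, hx⟩ y ⟨_, hy⟩ hxy
      by_contra hlt
      have hlt' : d x < d y := by simpa using hlt
      exact absurd ((key x y (hdlt y _ hlt')).2 hx) (not_lt.mpr hxy)
    · intro n
      refine (hD (-n).toNat).subset ?_
      rintro x ⟨⟨hx, _⟩, hn⟩
      have hn' : -(d x : ℤ) = n := hn
      refine ⟨hx, ?_⟩
      rw [← hn', neg_neg, Int.toNat_natCast]
      exact hd x
  refine HV.sum' (fun w => if w < U (d w) then 0 else 1) ?_ ?_
  · intro x _ y _ hxy
    by_cases hx : x < U (d x)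
    · simp only [if_pos hx]
      split_ifs <;> norm_num
    · have hx' : U (d x) < x := lt_of_le_of_ne (not_lt.mp hx) (hne x).symm
      have hy : ¬ y < U (d y) := by
        intro hy
        rcases lt_trichotomy (d x) (d y) with h1 | h1 | h1
        · exact absurd ((key x y (hdlt y _ h1)).2 hx') (not_lt.mpr hxy)
        · rw [← h1] at hy
          exact absurd (hy.trans hx') (not_lt.mpr hxy)
        · exact absurd ((key y x (hdlt x _ h1)).1 hy) (not_lt.mpr hxy)
      simp only [if_neg hx, if_neg hy]
      exact le_rfl
  · intro n
    refine ⟨Ordinal.omega0 ^ (h : Ordinal.{0}), by simp, ?_⟩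
    by_cases hn : n = 0
    · refine hlow.subset _ ?_
      rintro x ⟨hx, hxn⟩
      refine ⟨hx, ?_⟩
      by_contra hc
      have hc' : ¬ x < U (d x) := hc
      simp only [Set.mem_preimage, if_neg hc', Set.mem_singleton_iff] at hxn
      omega
    · refine hhigh.subset _ ?_
      rintro x ⟨hx, hxn⟩
      refine ⟨hx, ?_⟩
      by_contra hc
      have hc' : x < U (d x) := lt_of_le_of_ne (not_lt.mp hc) (hne x)
      simp only [Set.mem_preimage, if_pos hc', Set.mem_singleton_iff] at hxn
      omega

/-! ### A dense family of codes -/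

def TL : List Bool → List Bool → Prop
  | [], [] => False
  | [], b :: _ => b = true
  | a :: _, [] => a = false
  | a :: x, b :: y => (a = false ∧ b = true) ∨ (a = b ∧ TL x y)

def codeW : List Bool → List Bool
  | [] => [false, true]
  | a :: x => a :: a :: codeW x

theorem TL.div : ∀ {x y : List Bool}, TL x y → DivLt (codeW x) (codeW y)
  | [], [], h => by simp [TL] at h
  | [], b :: y, h => by
    simp only [TL] at h
    subst h
    exact ⟨[], [true], true :: codeW y, rfl, rfl⟩
  | a :: x, [], h => by
    simp only [TL] at h
    subst h
    exact ⟨[false], codeW x, [], rfl, rfl⟩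
  | a :: x, b :: y, h => by
    simp only [TL] at h
    rcases h with ⟨rfl, rfl⟩ | ⟨rfl, h⟩
    · exact ⟨[], false :: codeW x, true :: codeW y, rfl, rfl⟩
    · exact (TL.div h).append_left [a, a]

theorem TL.tri : ∀ (x y : List Bool), TL x y ∨ x = y ∨ TL y x
  | [], [] => by simp
  | [], b :: y => by cases b <;> simp [TL]
  | a :: x, [] => by cases a <;> simp [TL]
  | a :: x, b :: y => by
    have := TL.tri x y
    cases a <;> cases b <;> simp [TL] <;> tauto

theorem TL.snoc_false : ∀ x : List Bool, TL (x ++ [false]) x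
  | [] => by simp [TL]
  | a :: x => by simp [TL, TL.snoc_false x]

theorem TL.snoc_true : ∀ x : List Bool, TL x (x ++ [true])
  | [] => by simp [TL]
  | a :: x => by simp [TL, TL.snoc_true x]

theorem TL.dense : ∀ {x y : List Bool}, TL x y → ∃ z, TL x z ∧ TL z y
  | [], [], h => by simp [TL] at h
  | [], b :: y, h => by
    simp only [TL] at h
    subst h
    exact ⟨true :: (y ++ [false]), by simp [TL], by simp [TL, TL.snoc_false]⟩
  | a :: x, [], h => by
    simp only [TL] at h
    subst h
    exact ⟨false :: (x ++ [true]), by simp [TL, TL.snoc_true], by simp [TL]⟩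
  | a :: x, b :: y, h => by
    simp only [TL] at h
    rcases h with ⟨rfl, rfl⟩ | ⟨rfl, h⟩
    · exact ⟨[], by simp [TL], by simp [TL]⟩
    · obtain ⟨z, h1, h2⟩ := TL.dense h
      exact ⟨a :: z, by simp [TL, h1], by simp [TL, h2]⟩

/-- A language containing words extending all products of two diverging words
(after a fixed prefix) is not scattered. -/
theorem not_scattered {L : Set (List Bool)} (a b v0 : List Bool) (hab : DivLt a b)
    (hL : ∀ c : List Bool, ∃ s, v0 ++ c.flatMap (fun i => if i then b else a) ++ s ∈ L) :
    ¬ LexScattered L := by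
  intro hs
  choose s hs' using hL
  let E : List Bool → L := fun d => ⟨_, hs' (codeW d)⟩
  have hE : ∀ x y, TL x y → (E x).1 < (E y).1 := by
    intro x y hxy
    obtain ⟨p, q, r, h1, h2⟩ := hxy.div
    refine DivLt.lt ?_
    simp only [E]
    refine DivLt.append ?_ _ _
    refine DivLt.append_left ?_ _
    rw [h1, h2]
    simp only [List.flatMap_append, List.flatMap_cons]
    refine DivLt.append_left ?_ _
    exact hab.append _ _
  apply hs
  refine ⟨Set.range E, ⟨E [], ⟨_, rfl⟩, E [true], ⟨_, rfl⟩, hE _ _ (by simp [TL])⟩, ?_⟩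
  rintro _ ⟨x, rfl⟩ _ ⟨y, rfl⟩ hxy
  have hxy' : (E x).1 < (E y).1 := hxy
  have hT : TL x y := by
    rcases TL.tri x y with h | h | h
    · exact h
    · rw [h] at hxy'
      exact absurd hxy' (lt_irrefl _)
    · exact absurd (hE _ _ h) (not_lt.mpr hxy'.le)
  obtain ⟨z, h1, h2⟩ := hT.dense
  exact ⟨E z, ⟨z, rfl⟩, hE _ _ h1, hE _ _ h2⟩

/-! ### Grammars -/

section Grammar
variable {g : ContextFreeGrammar.{0} Bool}

theorem rewrites_append {r : ContextFreeRule Bool g.NT} (u v x : List (Symbol Bool g.NT))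
    (h : r.Rewrites (u ++ v) x) :
    (∃ u', r.Rewrites u u' ∧ x = u' ++ v) ∨ (∃ v', r.Rewrites v v' ∧ x = u ++ v') := by
  induction u generalizing x with
  | nil => exact Or.inr ⟨x, h, rfl⟩
  | cons a u ih =>
    rw [List.cons_append] at h
    cases h with
    | head s => exact Or.inl ⟨r.output ++ u, ContextFreeRule.Rewrites.head u, by simp⟩
    | cons _ hrs =>
      rcases ih _ hrs with ⟨u', h1, rfl⟩ | ⟨v', h1, rfl⟩
      · exact Or.inl ⟨a :: u', ContextFreeRule.Rewrites.cons a h1, rfl⟩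
      · exact Or.inr ⟨v', h1, rfl⟩

theorem derives_append_split {z w : List (Symbol Bool g.NT)} (h : g.Derives z w) :
    ∀ u v, z = u ++ v → ∃ w1 w2, w = w1 ++ w2 ∧ g.Derives u w1 ∧ g.Derives v w2 := by
  induction h using Relation.ReflTransGen.head_induction_on with
  | refl =>
    rintro u v rfl
    exact ⟨u, v, rfl, Relation.ReflTransGen.refl, Relation.ReflTransGen.refl⟩
  | head h1 _ ih =>
    rintro u v rfl
    obtain ⟨r, hr, h1⟩ := h1
    rcases rewrites_append u v _ h1 with ⟨u', h2, h3⟩ | ⟨v', h2, h3⟩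
    · obtain ⟨w1, w2, h4, h5, h6⟩ := ih u' v h3
      exact ⟨w1, w2, h4, Relation.ReflTransGen.head ⟨r, hr, h2⟩ h5, h6⟩
    · obtain ⟨w1, w2, h4, h5, h6⟩ := ih u v' h3
      exact ⟨w1, w2, h4, h5, Relation.ReflTransGen.head ⟨r, hr, h2⟩ h6⟩

theorem derives_append {u u' v v' : List (Symbol Bool g.NT)} (hu : g.Derives u u')
    (hv : g.Derives v v') : g.Derives (u ++ v) (u' ++ v') :=
  (hu.append_right v).trans (hv.append_left u')

variable (g) in
/-- Terminal words derived from a sentential form. -/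
def langS (γ : List (Symbol Bool g.NT)) : Set (List Bool) :=
  {w | g.Derives γ (w.map Symbol.terminal)}

theorem langS_append (α β : List (Symbol Bool g.NT)) :
    langS g (α ++ β) = Set.image2 (· ++ ·) (langS g α) (langS g β) := by
  ext w
  constructor
  · intro h
    obtain ⟨w1, w2, h1, h2, h3⟩ := derives_append_split h α β rfl
    obtain ⟨x, y, rfl, rfl, rfl⟩ := List.map_eq_append_iff.mp h1
    exact ⟨x, h2, y, h3, rfl⟩
  · rintro ⟨x, hx, y, hy, rfl⟩
    show g.Derives _ _
    simp only [List.map_append]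
    exact derives_append hx hy

theorem derives_map_terminal {v : List Bool} {x : List (Symbol Bool g.NT)}
    (h : g.Derives (v.map Symbol.terminal) x) : x = v.map Symbol.terminal := by
  rcases h.eq_or_head with h | ⟨y, ⟨r, hr, h1⟩, _⟩
  · exact h.symm
  · have := h1.nonterminal_input_mem
    simp at this

theorem langS_map (v : List Bool) : langS g (v.map Symbol.terminal) = {v} := by
  ext w
  constructor
  · intro h
    have h1 := derives_map_terminal h
    have hinj : Function.Injective (Symbol.terminal : Bool → Symbol Bool g.NT) :=
      fun a b h => by injection h
    exact List.map_injective_iff.mpr hinj h1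
  · rintro rfl
    exact Relation.ReflTransGen.refl

theorem langOf_rule {X : g.NT} {w : List Bool} (h : w ∈ langOf g X) :
    ∃ r ∈ g.rules, r.input = X ∧ w ∈ langS g r.output := by
  have h' : g.Derives [Symbol.nonterminal X] (w.map Symbol.terminal) := h
  rcases h'.eq_or_head with h | ⟨y, ⟨r, hr, h1⟩, h2⟩
  · exfalso
    have : Symbol.nonterminal X ∈ w.map (Symbol.terminal : Bool → Symbol Bool g.NT) := by
      rw [← h]; simp
    simp at this
  · obtain ⟨p, q, h3, h4⟩ := h1.exists_parts
    have hl := congrArg List.length h3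
    simp at hl
    have hp : p = [] := List.eq_nil_of_length_eq_zero (by omega)
    have hq : q = [] := List.eq_nil_of_length_eq_zero (by omega)
    subst hp hq
    simp at h3 h4
    subst h4
    exact ⟨r, hr, h3.symm, h2⟩

theorem derives_rule {r : ContextFreeRule Bool g.NT} (hr : r ∈ g.rules) :
    g.Derives [Symbol.nonterminal r.input] r.output :=
  ContextFreeGrammar.Produces.single ⟨r, hr, ContextFreeRule.Rewrites.input_output⟩

theorem derives_ne_nil (heps : ∀ r ∈ g.rules, r.output ≠ []) {γ δ : List (Symbol Bool g.NT)}
    (h : g.Derives γ δ) (hγ : γ ≠ []) : δ ≠ [] := by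
  induction h with
  | refl => exact hγ
  | tail _ h1 _ =>
    obtain ⟨r, hr, h1⟩ := h1
    obtain ⟨p, q, _, rfl⟩ := h1.exists_parts
    simp [heps r hr]

variable (g) in
/-- `Y` derives `v X s` with terminal words `v`, `s`. -/
def Ctx (Y : g.NT) (v : List Bool) (X : g.NT) (s : List Bool) : Prop :=
  g.Derives [Symbol.nonterminal Y]
    (v.map Symbol.terminal ++ [Symbol.nonterminal X] ++ s.map Symbol.terminal)

variable (g) in
def Reach (Y X : g.NT) : Prop := ∃ v s, Ctx g Y v X s

theorem Ctx.refl (X : g.NT) : Ctx g X [] X [] := Relation.ReflTransGen.refl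

theorem Ctx.trans {X Y Z : g.NT} {v s v' s' : List Bool} (h1 : Ctx g X v Y s)
    (h2 : Ctx g Y v' Z s') : Ctx g X (v ++ v') Z (s' ++ s) := by
  refine Relation.ReflTransGen.trans h1 ?_
  have := derives_append (derives_append (Relation.ReflTransGen.refl
    (a := v.map (Symbol.terminal : Bool → Symbol Bool g.NT))) h2)
    (Relation.ReflTransGen.refl (a := s.map (Symbol.terminal : Bool → Symbol Bool g.NT)))
  simpa using this

theorem Ctx.lang {X Y : g.NT} {v s w : List Bool} (h1 : Ctx g X v Y s) (h2 : w ∈ langOf g Y) :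
    v ++ w ++ s ∈ langOf g X := by
  refine Relation.ReflTransGen.trans h1 ?_
  have := derives_append (derives_append (Relation.ReflTransGen.refl
    (a := v.map (Symbol.terminal : Bool → Symbol Bool g.NT))) h2)
    (Relation.ReflTransGen.refl (a := s.map (Symbol.terminal : Bool → Symbol Bool g.NT)))
  simpa using this

theorem Ctx.of_derives {X Z : g.NT} {α β : List (Symbol Bool g.NT)}
    (h : g.Derives [Symbol.nonterminal X] (α ++ [Symbol.nonterminal Z] ++ β)) {v s : List Bool}
    (hv : v ∈ langS g α) (hs : s ∈ langS g β) : Ctx g X v Z s :=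
  Relation.ReflTransGen.trans h
    (derives_append (derives_append hv Relation.ReflTransGen.refl) hs)

theorem Reach.refl (X : g.NT) : Reach g X X := ⟨[], [], Ctx.refl X⟩

theorem Reach.trans {X Y Z : g.NT} : Reach g X Y → Reach g Y Z → Reach g X Z := by
  rintro ⟨v, s, h⟩ ⟨v', s', h'⟩
  exact ⟨_, _, h.trans h'⟩

theorem langS_nonempty (hne : ∀ X : g.NT, (langOf g X).Nonempty) (γ : List (Symbol Bool g.NT)) :
    (langS g γ).Nonempty := by
  induction γ with
  | nil => exact ⟨[], Relation.ReflTransGen.refl⟩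
  | cons a γ ih =>
    have : (langS g [a]).Nonempty := by
      cases a with
      | terminal c => exact ⟨[c], Relation.ReflTransGen.refl⟩
      | nonterminal X => exact hne X
    rw [show a :: γ = [a] ++ γ from rfl, langS_append]
    exact this.image2 ih

theorem langS_div (hpre : IsPrefixGrammar g)
    (htwo : ∀ X : g.NT, ∃ w₁ ∈ langOf g X, ∃ w₂ ∈ langOf g X, w₁ ≠ w₂)
    (hne : ∀ X : g.NT, (langOf g X).Nonempty)
    {γ : List (Symbol Bool g.NT)} {Z : g.NT} (hZ : Symbol.nonterminal Z ∈ γ) :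
    ∃ x ∈ langS g γ, ∃ y ∈ langS g γ, DivLt x y := by
  obtain ⟨α, β, rfl⟩ := List.append_of_mem hZ
  obtain ⟨p, hp⟩ := langS_nonempty hne α
  obtain ⟨q, hq⟩ := langS_nonempty hne β
  have key : ∀ z ∈ langOf g Z, p ++ (z ++ q) ∈ langS g (α ++ Symbol.nonterminal Z :: β) := by
    intro z hz
    rw [show Symbol.nonterminal Z :: β = [Symbol.nonterminal Z] ++ β from rfl, langS_append,
      langS_append]
    exact ⟨p, hp, _, ⟨z, hz, q, hq, rfl⟩, rfl⟩
  have key2 : ∃ x ∈ langOf g Z, ∃ y ∈ langOf g Z, DivLt x y := by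
    obtain ⟨x, hx, y, hy, hxy⟩ := htwo Z
    rcases word_cases x y with h | h | h | h
    · exact ⟨x, hx, y, hy, h⟩
    · exact ⟨y, hy, x, hx, h⟩
    · exact absurd (hpre Z x hx y hy h) hxy
    · exact absurd (hpre Z y hy x hx h).symm hxy
  obtain ⟨x, hx, y, hy, hxy⟩ := key2
  exact ⟨_, key x hx, _, key y hy, (hxy.append q q).append_left p⟩

theorem no_div (hscat : LexScattered (langOf g g.initial))
    (hne : ∀ X : g.NT, (langOf g X).Nonempty) (hreach : ∀ X : g.NT, Reach g g.initial X)
    {X Y Y' : g.NT} {v s v' s' : List Bool}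
    (h1 : Ctx g X v Y s) (h2 : Reach g Y X) (h1' : Ctx g X v' Y' s') (h2' : Reach g Y' X) :
    ¬ DivLt v v' := by
  intro hd
  obtain ⟨x, t, h2⟩ := h2
  obtain ⟨x', t', h2'⟩ := h2'
  obtain ⟨v0, s0, h0⟩ := hreach X
  obtain ⟨w, hw⟩ := hne X
  have ha := h1.trans h2
  have hb := h1'.trans h2'
  refine not_scattered (v ++ x) (v' ++ x') v0 (hd.append _ _) ?_ hscat
  intro c
  have hc : ∃ s, Ctx g X (c.flatMap (fun i => if i then v' ++ x' else v ++ x)) X s := by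
    induction c with
    | nil => exact ⟨[], Ctx.refl X⟩
    | cons i c ih =>
      obtain ⟨r, ih⟩ := ih
      cases i with
      | false => exact ⟨_, ha.trans ih⟩
      | true => exact ⟨_, hb.trans ih⟩
  obtain ⟨r, hr⟩ := hc
  refine ⟨w ++ (r ++ s0), ?_⟩
  have := (h0.trans hr).lang hw
  rwa [List.append_assoc] at this

theorem langS_CH {h : ℕ} (hpre : IsPrefixGrammar g) (γ : List (Symbol Bool g.NT))
    (hγ : ∀ Z, Symbol.nonterminal Z ∈ γ → CH h (langOf g Z)) : CH h (langS g γ) := by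
  induction γ with
  | nil =>
    have : langS g [] = {[]} := langS_map (g := g) []
    rw [this]
    exact CH.of_subsingleton Set.subsingleton_singleton
  | cons a γ ih =>
    rw [show a :: γ = [a] ++ γ from rfl, langS_append]
    have ih' := ih (fun Z hZ => hγ Z (by simp [hZ]))
    cases a with
    | terminal c =>
      have : langS g [Symbol.terminal c] = {[c]} := langS_map (g := g) [c]
      rw [this]
      refine CH.concat (CH.of_subsingleton Set.subsingleton_singleton) ih' ?_
      rintro u hu v hv _
      rw [Set.mem_singleton_iff] at hu hv
      rw [hu, hv]
    | nonterminal X => exact CH.concat (hγ X (by simp)) ih' (hpre X)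

theorem eq_map_terminal (γ : List (Symbol Bool g.NT))
    (h : ∀ Z, Symbol.nonterminal Z ∉ γ) : ∃ v : List Bool, γ = v.map Symbol.terminal := by
  induction γ with
  | nil => exact ⟨[], rfl⟩
  | cons a γ ih =>
    obtain ⟨v, rfl⟩ := ih (fun Z hZ => h Z (by simp [hZ]))
    cases a with
    | terminal c => exact ⟨c :: v, rfl⟩
    | nonterminal X => exact absurd (by simp) (h X)

theorem leftrec_wf [Finite g.NT] (hpre : IsPrefixGrammar g)
    (hne : ∀ X : g.NT, (langOf g X).Nonempty) :
    WellFounded (fun Z Y : g.NT => ∃ s, s ≠ [] ∧ Ctx g Y [] Z s) := by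
  have h1 : IsTrans g.NT (fun Z Y : g.NT => ∃ s, s ≠ [] ∧ Ctx g Y [] Z s) := ⟨by
    rintro A B C ⟨s, hs, h⟩ ⟨s', hs', h'⟩
    exact ⟨s ++ s', by simp [hs], h'.trans h⟩⟩
  have h2 : Std.Irrefl (fun Z Y : g.NT => ∃ s, s ≠ [] ∧ Ctx g Y [] Z s) := ⟨by
    rintro A ⟨s, hs, h⟩
    obtain ⟨w, hw⟩ := hne A
    have h3 := h.lang hw
    have h4 := hpre A _ hw _ h3 (by simp)
    simp at h4
    exact hs h4⟩
  exact Finite.wellFounded_of_trans_of_irrefl _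

theorem rank_step [Finite g.NT] (hpre : IsPrefixGrammar g)
    (hscat : LexScattered (langOf g g.initial))
    (heps : ∀ r ∈ g.rules, r.output ≠ [])
    (hchain : ∀ r ∈ g.rules, ∀ Y : g.NT, r.output ≠ [Symbol.nonterminal Y])
    (htwo : ∀ X : g.NT, ∃ w₁ ∈ langOf g X, ∃ w₂ ∈ langOf g X, w₁ ≠ w₂)
    (hne : ∀ X : g.NT, (langOf g X).Nonempty) (hreach : ∀ X : g.NT, Reach g g.initial X)
    (X : g.NT) (h : ℕ)
    (hlow : ∀ Z, Reach g X Z → ¬ Reach g Z X → CH h (langOf g Z)) :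
    HV (Ordinal.omega0 ^ (h : Ordinal.{0}) + 1) (langOf g X) := by
  classical
  let W : Set (List Bool) := {v | ∃ Y s, Ctx g X v Y s ∧ Reach g Y X}
  have hW : ∀ v ∈ W, ∀ v' ∈ W, v <+: v' ∨ v' <+: v := by
    rintro v ⟨Y, s, h1, h2⟩ v' ⟨Y', s', h1', h2'⟩
    rcases word_cases v v' with hc | hc | hc | hc
    · exact absurd hc (no_div hscat hne hreach h1 h2 h1' h2')
    · exact absurd hc (no_div hscat hne hreach h1' h2' h1 h2)
    · exact Or.inl hc
    · exact Or.inr hc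
  let U : ℕ → List Bool := fun m =>
    if hm : ∃ w ∈ W, m ≤ w.length then hm.choose.take m else List.replicate m false
  have hUlen : ∀ m, (U m).length = m := by
    intro m
    by_cases hm : ∃ w ∈ W, m ≤ w.length
    · simp only [U, dif_pos hm, List.length_take]
      exact min_eq_left hm.choose_spec.2
    · simp only [U, dif_neg hm, List.length_replicate]
  have hUW : ∀ m, ∀ v ∈ W, m ≤ v.length → U m <+: v := by
    intro m v hv hmv
    have hm : ∃ w ∈ W, m ≤ w.length := ⟨v, hv, hmv⟩
    simp only [U, dif_pos hm]
    have hp : hm.choose.take m <+: hm.choose := List.take_prefix _ _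
    rcases hW v hv _ hm.choose_spec.1 with h1 | h1
    · refine List.prefix_of_prefix_length_le hp h1 ?_
      simp only [List.length_take]
      omega
    · exact hp.trans h1
  refine rank_of_spine U hUlen (fun m => ?_)
  have main : ∀ j : ℕ, ∀ Y : g.NT, ∀ v s, Ctx g X v Y s → Reach g Y X → m ≤ v.length + j →
      CH h {w ∈ langOf g Y | ¬ U m <+: v ++ w} := by
    intro j
    induction j with
    | zero =>
      intro Y v s h1 h2 hm
      refine CH.of_subsingleton (Set.subsingleton_empty.anti ?_)
      rintro w ⟨_, hw⟩
      exact hw ((hUW m v ⟨Y, s, h1, h2⟩ (by omega)).trans (List.prefix_append _ _))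
    | succ j ihj =>
      intro Y
      induction Y using (leftrec_wf hpre hne).induction with
      | _ Y ihY =>
      intro v s h1 h2 hm
      refine (CH.biUnion (h := h) g.rules (fun r => {w | r.input = Y ∧ w ∈ langS g r.output ∧
        ¬ U m <+: v ++ w}) ?_).subset ?_
      swap
      · rintro w ⟨hw, hw'⟩
        obtain ⟨r, hr, hrY, hwr⟩ := langOf_rule hw
        simp only [Set.mem_iUnion]
        exact ⟨r, hr, hrY, hwr, hw'⟩
      intro r hr
      by_cases hrY : r.input = Y
      swap
      · refine CH.of_subsingleton (Set.subsingleton_empty.anti ?_)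
        rintro w ⟨hw, _⟩
        exact hrY hw
      have hder : g.Derives [Symbol.nonterminal Y] r.output := hrY ▸ derives_rule hr
      -- left contexts of recursive nonterminals are terminal
      have hleft : ∀ (Z : g.NT) (α β : List (Symbol Bool g.NT)),
          r.output = α ++ [Symbol.nonterminal Z] ++ β → Reach g Z X →
          ∀ Z', Symbol.nonterminal Z' ∉ α := by
        intro Z α β hout hZ Z' hZ'
        obtain ⟨x, hx, y, hy, hxy⟩ := langS_div hpre htwo hne hZ'
        obtain ⟨t, ht⟩ := langS_nonempty hne β
        rw [hout] at hder
        have hx' := h1.trans (Ctx.of_derives hder hx ht)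
        have hy' := h1.trans (Ctx.of_derives hder hy ht)
        exact no_div hscat hne hreach hx' hZ hy' hZ (hxy.append_left v)
      have hlow' : ∀ Z, Symbol.nonterminal Z ∈ r.output → ¬ Reach g Z X → CH h (langOf g Z) := by
        intro Z hZ hZX
        refine hlow Z ?_ hZX
        obtain ⟨α, β, hout⟩ := List.append_of_mem hZ
        obtain ⟨x, hx⟩ := langS_nonempty hne α
        obtain ⟨t, ht⟩ := langS_nonempty hne β
        have hder' : g.Derives [Symbol.nonterminal Y] (α ++ [Symbol.nonterminal Z] ++ β) := by
          rw [hout] at hder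
          simpa using hder
        exact ⟨_, _, h1.trans (Ctx.of_derives hder' hx ht)⟩
      by_cases hrec : ∃ Z, Symbol.nonterminal Z ∈ r.output ∧ Reach g Z X
      swap
      · push Not at hrec
        refine (langS_CH hpre r.output (fun Z hZ => hlow' Z hZ (hrec Z hZ))).subset ?_
        rintro w ⟨_, hw, _⟩
        exact hw
      obtain ⟨Z, hZ, hZX⟩ := hrec
      obtain ⟨α, β, hout⟩ := List.append_of_mem hZ
      replace hout : r.output = α ++ [Symbol.nonterminal Z] ++ β := by simpa using hout
      obtain ⟨v', rfl⟩ := eq_map_terminal α (hleft Z α β hout hZX)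
      have hβ : CH h (langS g β) := by
        refine langS_CH hpre β (fun Z' hZ' => hlow' Z' (by rw [hout]; simp [hZ']) ?_)
        intro hZ'X
        obtain ⟨β1, β2, rfl⟩ := List.append_of_mem hZ'
        refine hleft Z' (v'.map Symbol.terminal ++ [Symbol.nonterminal Z] ++ β1) β2 ?_ hZ'X Z ?_
        · rw [hout]; simp
        · simp
      obtain ⟨t, ht⟩ := langS_nonempty hne β
      have hv' : v' ∈ langS g (v'.map Symbol.terminal) := by rw [langS_map]; rfl
      rw [hout] at hder
      have hctx : Ctx g Y v' Z t := Ctx.of_derives hder hv' ht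
      have hZCH : CH h {w ∈ langOf g Z | ¬ U m <+: (v ++ v') ++ w} := by
        by_cases hv0 : v' = []
        · subst hv0
          refine ihY Z ⟨t, ?_, hctx⟩ _ _ (h1.trans hctx) hZX (by simpa using hm)
          have hβne : β ≠ [] := by
            rintro rfl
            exact hchain r hr Z (by simpa using hout)
          have := derives_ne_nil heps ht hβne
          simpa using this
        · refine ihj Z _ _ (h1.trans hctx) hZX ?_
          have : 0 < v'.length := List.length_pos_iff.mpr hv0
          simp only [List.length_append]
          omega
      have hconc := CH.concat (CH.of_subsingleton (h := h) (Set.subsingleton_singleton (a := v')))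
        (CH.concat hZCH hβ ((hpre Z).mono (fun w hw => hw.1))) (by
          rintro a ha b hb _
          rw [Set.mem_singleton_iff] at ha hb
          rw [ha, hb])
      refine hconc.subset ?_
      rintro w ⟨_, hw, hwU⟩
      rw [hout, List.append_assoc, langS_append, langS_append, langS_map] at hw
      obtain ⟨x, hx, y, ⟨z, hz, q, hq, rfl⟩, rfl⟩ := hw
      rw [Set.mem_singleton_iff] at hx
      subst hx
      refine ⟨x, rfl, _, ⟨z, ⟨hz, fun hU => hwU ?_⟩, q, hq, rfl⟩, rfl⟩
      refine hU.trans ⟨q, ?_⟩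
      simp
  have := main m X [] [] (Ctx.refl X) (Reach.refl X) (by simp)
  simpa using this

theorem rank_main [Fintype g.NT] (hpre : IsPrefixGrammar g)
    (hscat : LexScattered (langOf g g.initial))
    (heps : ∀ r ∈ g.rules, r.output ≠ [])
    (hchain : ∀ r ∈ g.rules, ∀ Y : g.NT, r.output ≠ [Symbol.nonterminal Y])
    (htwo : ∀ X : g.NT, ∃ w₁ ∈ langOf g X, ∃ w₂ ∈ langOf g X, w₁ ≠ w₂)
    (hne : ∀ X : g.NT, (langOf g X).Nonempty) (hreach : ∀ X : g.NT, Reach g g.initial X) :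
    ∀ (k : ℕ) (X : g.NT), Set.ncard {Z | Reach g X Z ∧ ¬ Reach g Z X} = k →
      HV (Ordinal.omega0 ^ (k : Ordinal.{0}) + 1) (langOf g X) := by
  intro k
  induction k using Nat.strong_induction_on with
  | _ k ih =>
  intro X hX
  refine rank_step hpre hscat heps hchain htwo hne hreach X k ?_
  intro Z hXZ hZX
  have hlt : Set.ncard {Z' | Reach g Z Z' ∧ ¬ Reach g Z' Z} < k := by
    rw [← hX]
    refine Set.ncard_lt_ncard ⟨?_, ?_⟩ (Set.toFinite _)
    · rintro Z' ⟨h1, h2⟩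
      exact ⟨hXZ.trans h1, fun h3 => h2 (h3.trans hXZ)⟩
    · intro hsub
      exact (hsub (show Z ∈ _ from ⟨hXZ, hZX⟩)).2 (Reach.refl Z)
  exact CH.of_lower hlt (ih _ hlt Z rfl)

end Grammar

/-- For a scattered grammar over `{0,1}` with `n` nonterminals, `ε`-free and
chain-free, without useless nonterminals, in which each nonterminal generates at
least two words, the Hausdorff rank of `(L(G), <_ℓ)` is at most `ω^(n-1) + 1`;
in particular it is less than `ω^ω`. -/
theorem hrank_scattered_grammar (g : ContextFreeGrammar.{0} Bool) [Fintype g.NT]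
    (n : ℕ) (hn : Fintype.card g.NT = n) (hn1 : 1 ≤ n)
    (hpre : IsPrefixGrammar g) (huse : NoUselessNonterminals g)
    (hscat : LexScattered (langOf g g.initial))
    (heps : ∀ r ∈ g.rules, r.output ≠ [])
    (hchain : ∀ r ∈ g.rules, ∀ Y : g.NT, r.output ≠ [Symbol.nonterminal Y])
    (htwo : ∀ X : g.NT, ∃ w₁ ∈ langOf g X, ∃ w₂ ∈ langOf g X, w₁ ≠ w₂) :
    langRank (langOf g g.initial) ≤ Ordinal.omega0 ^ ((n - 1 : ℕ) : Ordinal) + 1 ∧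
    langRank (langOf g g.initial) < Ordinal.omega0 ^ Ordinal.omega0 := by
  have hne : ∀ X : g.NT, (langOf g X).Nonempty := fun X => (huse X).2
  have hreach : ∀ X : g.NT, Reach g g.initial X := by
    intro X
    obtain ⟨⟨p, q, hpq⟩, _⟩ := huse X
    obtain ⟨v, hv⟩ := langS_nonempty hne p
    obtain ⟨s, hs⟩ := langS_nonempty hne q
    exact ⟨v, s, Ctx.of_derives hpq hv hs⟩
  have hHV := rank_main hpre hscat heps hchain htwo hne hreach _ g.initial rfl
  set k := Set.ncard {Z | Reach g g.initial Z ∧ ¬ Reach g Z g.initial} with hk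
  have hkn : k < n := by
    rw [← hn, ← Nat.card_eq_fintype_card, ← Set.ncard_univ]
    refine Set.ncard_lt_ncard ⟨Set.subset_univ _, fun hsub => ?_⟩ (Set.toFinite _)
    exact (hsub (Set.mem_univ g.initial)).2 (Reach.refl _)
  have hle : langRank (langOf g g.initial) ≤
      Ordinal.omega0 ^ ((n - 1 : ℕ) : Ordinal.{0}) + 1 := by
    have h1 : langRank (langOf g g.initial) ≤ Ordinal.omega0 ^ (k : Ordinal.{0}) + 1 :=
      csInf_le' hHV.inV
    refine h1.trans ?_
    have h2 : (k : Ordinal.{0}) ≤ ((n - 1 : ℕ) : Ordinal.{0}) := by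
      exact_mod_cast (by omega : k ≤ n - 1)
    have h3 := Ordinal.opow_le_opow_right Ordinal.omega0_pos h2
    gcongr
  refine ⟨hle, hle.trans_lt ?_⟩
  have hp := Ordinal.isPrincipal_add_omega0_opow Ordinal.omega0
  refine hp ?_ (Ordinal.one_lt_opow.mpr ⟨Ordinal.one_lt_omega0, Ordinal.omega0_ne_zero⟩)
  exact (Ordinal.opow_lt_opow_iff_right Ordinal.one_lt_omega0).mpr (Ordinal.natCast_lt_omega0 _)
end
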